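/- Let V be a k-dimensional real inner product space and t₀ ∈ ℝ. Let Ŝ, R̂ : [t₀, ∞) → End(V) be smooth families of self-adjoint endomorphisms satisfying Ŝ'(t) + Ŝ(t)² + R̂(t) = 0 for all t ∈ [t₀, ∞). If trace Ŝ(t₀) ≤ 0 and trace R̂(t) ≥ 0 for all t ∈ [t₀, ∞), then Ŝ(t) = 0 and R̂(t) = 0 for all t ∈ [t₀, ∞). -/

import Mathlib

open RealInnerProductSpace

/-- A global solution of `f' ≤ -c f²` on `[t₀, ∞)` with `c > 0` cannot become negative,
since otherwise it would blow down in finite time. -/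
theorem nonneg_of_deriv_le_neg_mul_sq {f f' : ℝ → ℝ} {t₀ c : ℝ} (hc : 0 < c)
    (hf : ∀ t ∈ Set.Ici t₀, HasDerivAt f (f' t) t)
    (hle : ∀ t ∈ Set.Ici t₀, f' t ≤ -(c * f t ^ 2)) :
    ∀ t ∈ Set.Ici t₀, 0 ≤ f t := by
  intro t₁ ht₁
  by_contra! hneg
  have hsub : ∀ t ∈ Set.Ici t₁, t ∈ Set.Ici t₀ := fun t ht => le_trans (Set.mem_Ici.1 ht₁) ht
  have hanti : AntitoneOn f (Set.Ici t₁) := by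
    refine antitoneOn_of_hasDerivWithinAt_nonpos (f' := f') (convex_Ici t₁)
      (fun t ht => (hf t (hsub t ht)).continuousAt.continuousWithinAt) (fun t ht => ?_)
      (fun t ht => ?_)
    · exact (hf t (hsub t (interior_subset ht))).hasDerivWithinAt
    · have := hle t (hsub t (interior_subset ht))
      have : 0 ≤ c * f t ^ 2 := by positivity
      linarith
  have hlt : ∀ t ∈ Set.Ici t₁, f t < 0 := fun t ht =>
    (hanti Set.self_mem_Ici ht ht).trans_lt hneg
  have hder : ∀ t ∈ Set.Ici t₁,
      HasDerivAt (fun u => (f u)⁻¹ - c * u) (-f' t / f t ^ 2 - c * 1) t := fun t ht =>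
    ((hf t (hsub t ht)).fun_inv (hlt t ht).ne).sub ((hasDerivAt_id t).const_mul c)
  have hmono : MonotoneOn (fun u => (f u)⁻¹ - c * u) (Set.Ici t₁) := by
    refine monotoneOn_of_hasDerivWithinAt_nonneg (convex_Ici t₁)
      (fun t ht => (hder t ht).continuousAt.continuousWithinAt)
      (fun t ht => (hder t (interior_subset ht)).hasDerivWithinAt) (fun t ht => ?_)
    have hpos : 0 < f t ^ 2 := sq_pos_of_neg (hlt t (interior_subset ht))
    have := hle t (hsub t (interior_subset ht))
    rw [mul_one, sub_nonneg, le_div_iff₀ hpos]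
    linarith
  set d : ℝ := -(f t₁)⁻¹ / c with hd
  have hd_pos : 0 ≤ d := div_nonneg (neg_nonneg.2 (inv_lt_zero.2 hneg).le) hc.le
  have hmem : t₁ + d ∈ Set.Ici t₁ := by simpa using hd_pos
  have h := hmono Set.self_mem_Ici hmem hmem
  have hcd : c * d = -(f t₁)⁻¹ := by rw [hd]; field_simp
  have hinv := inv_lt_zero.2 (hlt _ hmem)
  simp only [mul_add, hcd] at h
  linarith

section SelfAdjoint

variable {V : Type*} [NormedAddCommGroup V] [InnerProductSpace ℝ V]

/-- The trace of the square of a self-adjoint operator is the square of its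
Hilbert-Schmidt norm. -/
theorem LinearMap.IsSymmetric.trace_comp_self {ι : Type*} [Fintype ι] {A : V →ₗ[ℝ] V}
    (hA : A.IsSymmetric) (b : OrthonormalBasis ι ℝ V) :
    LinearMap.trace ℝ V (A ∘ₗ A) = ∑ i, ‖A (b i)‖ ^ 2 := by
  rw [LinearMap.trace_eq_sum_inner _ b]
  refine Finset.sum_congr rfl fun i _ => ?_
  rw [LinearMap.comp_apply, ← hA, real_inner_self_eq_norm_sq]

variable [FiniteDimensional ℝ V]

theorem LinearMap.IsSymmetric.sq_trace_le {A : V →ₗ[ℝ] V} (hA : A.IsSymmetric) :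
    LinearMap.trace ℝ V A ^ 2 ≤ Module.finrank ℝ V * LinearMap.trace ℝ V (A ∘ₗ A) := by
  let b := stdOrthonormalBasis ℝ V
  rw [hA.trace_comp_self b, LinearMap.trace_eq_sum_inner _ b]
  refine sq_sum_le_card_mul_sum_sq.trans ?_
  rw [Finset.card_univ, Fintype.card_fin]
  refine mul_le_mul_of_nonneg_left (Finset.sum_le_sum fun i _ => ?_) (Nat.cast_nonneg _)
  rw [sq_le_sq, abs_norm]
  simpa using abs_real_inner_le_norm (b i) (A (b i))

theorem LinearMap.IsSymmetric.trace_comp_self_nonneg {A : V →ₗ[ℝ] V} (hA : A.IsSymmetric) :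
    0 ≤ LinearMap.trace ℝ V (A ∘ₗ A) := by
  rw [hA.trace_comp_self (stdOrthonormalBasis ℝ V)]
  positivity

theorem LinearMap.IsSymmetric.eq_zero_of_trace_comp_self {A : V →ₗ[ℝ] V} (hA : A.IsSymmetric)
    (h : LinearMap.trace ℝ V (A ∘ₗ A) = 0) : A = 0 := by
  let b := stdOrthonormalBasis ℝ V
  rw [hA.trace_comp_self b, Finset.sum_eq_zero_iff_of_nonneg fun i _ => by positivity] at h
  exact b.toBasis.ext fun i => by simpa using h i (Finset.mem_univ i)

end SelfAdjoint

/-- **Long-time rigidity for nonnegative trace curvature.** If `Ŝ' + Ŝ² + R̂ = 0`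
on `[t₀, ∞)` for smooth families of self-adjoint endomorphisms of a
`k`-dimensional inner product space, with `trace Ŝ(t₀) ≤ 0` and `trace R̂ ≥ 0`,
then `Ŝ ≡ 0` and `R̂ ≡ 0` on `[t₀, ∞)`. -/
theorem trace_riccati_nonneg_rigidity
    {V : Type*} [NormedAddCommGroup V] [InnerProductSpace ℝ V] [FiniteDimensional ℝ V]
    (k : ℕ) (hk : Module.finrank ℝ V = k)
    (t₀ : ℝ)
    (S R : ℝ → V →L[ℝ] V)
    (hS_smooth : ContDiffOn ℝ (⊤ : ℕ∞) S (Set.Ici t₀))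
    (hR_smooth : ContDiffOn ℝ (⊤ : ℕ∞) R (Set.Ici t₀))
    (hS_sym : ∀ t ∈ Set.Ici t₀, ∀ x y : V, ⟪S t x, y⟫ = ⟪x, S t y⟫)
    (hR_sym : ∀ t ∈ Set.Ici t₀, ∀ x y : V, ⟪R t x, y⟫ = ⟪x, R t y⟫)
    (hRiccati : ∀ t ∈ Set.Ici t₀, HasDerivAt S (-((S t).comp (S t)) - R t) t)
    (hS0 : LinearMap.trace ℝ V (S t₀ : V →ₗ[ℝ] V) ≤ 0)
    (hRtr : ∀ t ∈ Set.Ici t₀, 0 ≤ LinearMap.trace ℝ V (R t : V →ₗ[ℝ] V)) :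
    ∀ t ∈ Set.Ici t₀, S t = 0 ∧ R t = 0 := by
  let T : (V →L[ℝ] V) →L[ℝ] ℝ := LinearMap.toContinuousLinearMap
    (LinearMap.trace ℝ V ∘ₗ ContinuousLinearMap.coeLM ℝ)
  have hT (A : V →L[ℝ] V) : T A = LinearMap.trace ℝ V (A : V →ₗ[ℝ] V) := rfl
  have hsym : ∀ t ∈ Set.Ici t₀, (S t : V →ₗ[ℝ] V).IsSymmetric := hS_sym
  have hderiv : ∀ t ∈ Set.Ici t₀, HasDerivAt (fun u => T (S u))
      (T (-((S t).comp (S t)) - R t)) t := fun t ht =>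
    T.hasFDerivAt.comp_hasDerivAt t (hRiccati t ht)
  have hval (t : ℝ) : T (-((S t).comp (S t)) - R t) =
      -LinearMap.trace ℝ V ((S t : V →ₗ[ℝ] V) ∘ₗ (S t : V →ₗ[ℝ] V)) -
        LinearMap.trace ℝ V (R t : V →ₗ[ℝ] V) := by
    rw [map_sub, map_neg]
    rfl
  have hnonpos : ∀ t ∈ Set.Ici t₀, T (S t) ≤ 0 := by
    have hanti : AntitoneOn (fun u => T (S u)) (Set.Ici t₀) := by
      refine antitoneOn_of_hasDerivWithinAt_nonpos (convex_Ici t₀)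
        (fun t ht => (hderiv t ht).continuousAt.continuousWithinAt)
        (fun t ht => (hderiv t (interior_subset ht)).hasDerivWithinAt) (fun t ht => ?_)
      have ht' := interior_subset ht
      rw [hval]
      linarith [(hsym t ht').trace_comp_self_nonneg, hRtr t ht']
    exact fun t ht => (hanti Set.self_mem_Ici ht ht).trans hS0
  have hnonneg : ∀ t ∈ Set.Ici t₀, 0 ≤ T (S t) := by
    refine nonneg_of_deriv_le_neg_mul_sq (c := ((k : ℝ) + 1)⁻¹) (by positivity) hderiv
      fun t ht => ?_
    have hsq := (hsym t ht).sq_trace_le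
    have htr := (hsym t ht).trace_comp_self_nonneg
    have hbound : ((k : ℝ) + 1)⁻¹ * T (S t) ^ 2 ≤
        LinearMap.trace ℝ V ((S t : V →ₗ[ℝ] V) ∘ₗ (S t : V →ₗ[ℝ] V)) := by
      rw [inv_mul_le_iff₀ (by positivity), hT]
      rw [hk] at hsq
      linarith
    rw [hval]
    linarith [hRtr t ht]
  have hzero : ∀ t ∈ Set.Ici t₀, T (S t) = 0 := fun t ht =>
    le_antisymm (hnonpos t ht) (hnonneg t ht)
  have hS : ∀ t ∈ Set.Ici t₀, S t = 0 := by
    intro t ht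
    have h : T (-((S t).comp (S t)) - R t) = 0 :=
      (uniqueDiffOn_Ici t₀ t ht).eq_deriv _ (hderiv t ht).hasDerivWithinAt
        ((hasDerivWithinAt_const t _ 0).congr_of_mem hzero ht)
    rw [hval] at h
    refine ContinuousLinearMap.coe_injective ((hsym t ht).eq_zero_of_trace_comp_self ?_)
    linarith [(hsym t ht).trace_comp_self_nonneg, hRtr t ht]
  intro t ht
  refine ⟨hS t ht, ?_⟩
  have h : -((S t).comp (S t)) - R t = 0 :=
    (uniqueDiffOn_Ici t₀ t ht).eq_deriv _ (hRiccati t ht).hasDerivWithinAt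
      ((hasDerivWithinAt_const t _ 0).congr_of_mem hS ht)
  simpa [hS t ht] using h
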